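/- Suppose a : ℕ → ℂ is an arithmetical function and (a_q)_{q≥1} is a sequence of complex numbers such that the series Σ_{q=1}^∞ a_q c_q(n) converges to a(n) absolutely and uniformly in n (i.e. Σ_{q=1}^∞ sup_{n≥1} |a_q c_q(n)| < ∞). Then for every positive integer q, the limit lim_{N→∞} (1/N) Σ_{n≤N} a(n) c_q(n) exists and a_q = (1/φ(q)) · lim_{N→∞} (1/N) Σ_{n≤N} a(n) c_q(n). -/

import Mathlib

open Finset Filter

/-- The Ramanujan sum `c_q(n) = ∑_{k=1, gcd(k,q)=1}^{q} e^{2πi k n / q}`. -/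
noncomputable def ramanujanSum (q n : ℕ) : ℂ :=
  ∑ k ∈ (Finset.Icc 1 q).filter (fun k => Nat.gcd k q = 1),
    Complex.exp (2 * Real.pi * Complex.I * k * n / q)

/-- The Ramanujan sum is the power sum over the primitive roots of unity. -/
theorem ramanujanSum_eq_sum_primitiveRoots {q : ℕ} (hq : 1 ≤ q) (n : ℕ) :
    ramanujanSum q n = ∑ z ∈ primitiveRoots q ℂ, z ^ n := by
  have hq0 : q ≠ 0 := by omega
  have : NeZero q := ⟨hq0⟩
  have hz := Complex.isPrimitiveRoot_exp q hq0
  set w : ℂ := Complex.exp (2 * Real.pi * Complex.I / q) with hw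
  unfold ramanujanSum
  refine Finset.sum_bij (fun k _ => w ^ k) ?_ ?_ ?_ ?_
  · intro k hk
    exact (mem_primitiveRoots hq).2 (hz.pow_of_coprime k (Finset.mem_filter.1 hk).2)
  · intro k hk l hl h
    simp only [Finset.mem_filter, Finset.mem_Icc] at hk hl
    obtain ⟨k, rfl⟩ := Nat.exists_eq_add_of_le' hk.1.1
    obtain ⟨l, rfl⟩ := Nat.exists_eq_add_of_le' hl.1.1
    have h' : w ^ k = w ^ l := by
      simpa [pow_succ, Complex.exp_ne_zero, hw] using h
    rw [hz.pow_inj (by omega) (by omega) h']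
  · intro z hzq
    obtain ⟨i, hi, hcop, rfl⟩ := hz.isPrimitiveRoot_iff.1 ((mem_primitiveRoots hq).1 hzq)
    rcases Nat.eq_zero_or_pos i with rfl | hpos
    · obtain rfl : q = 1 := by simpa using hcop
      exact ⟨1, by simp, by simpa using hz.pow_eq_one⟩
    · exact ⟨i, Finset.mem_filter.2 ⟨Finset.mem_Icc.2 ⟨hpos, hi.le⟩, hcop⟩, rfl⟩
  · intro k _
    rw [hw, ← Complex.exp_nat_mul, ← Complex.exp_nat_mul]
    congr 1
    ring

theorem norm_ramanujanSum_le {q : ℕ} (hq : 1 ≤ q) (n : ℕ) :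
    ‖ramanujanSum q n‖ ≤ Nat.totient q := by
  rw [ramanujanSum_eq_sum_primitiveRoots hq, ← Complex.card_primitiveRoots q]
  refine (norm_sum_le_of_le (f := fun z : ℂ => z ^ n) (n := fun _ => 1) _ fun z hz => ?_).trans_eq
    (by simp)
  rw [norm_pow, (isPrimitiveRoot_of_mem_primitiveRoots hz).norm'_eq_one (by omega), one_pow]

/-- The mean value of the powers of a point of the unit circle. -/
theorem tendsto_mean_pow {w : ℂ} (hw : ‖w‖ = 1) :
    Tendsto (fun N : ℕ => (1 / (N : ℂ)) * ∑ n ∈ Finset.Icc 1 N, w ^ n) atTop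
      (nhds (if w = 1 then 1 else 0)) := by
  split_ifs with h
  · subst h
    refine tendsto_const_nhds.congr' ?_
    filter_upwards [eventually_ne_atTop 0] with N hN
    simp [hN]
  · have hne : w - 1 ≠ 0 := sub_ne_zero.2 h
    have hsum : ∀ N : ℕ, ∑ n ∈ Finset.Icc 1 N, w ^ n = w * (w ^ N - 1) / (w - 1) := by
      intro N
      induction N with
      | zero => simp
      | succ N ih =>
        rw [Finset.sum_Icc_succ_top (by omega), ih]
        field_simp
        ring
    refine squeeze_zero_norm (a := fun N : ℕ => (2 / ‖w - 1‖) / (N : ℝ)) (fun N => ?_)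
      (tendsto_const_div_atTop_nhds_zero_nat _)
    have hle : ‖w ^ N - 1‖ ≤ 2 := by
      refine (norm_sub_le _ _).trans ?_
      rw [norm_pow, hw]
      norm_num
    rw [hsum, norm_mul, norm_div, norm_div, norm_mul, hw, one_mul, norm_one, Complex.norm_natCast,
      one_div_mul_eq_div]
    gcongr

/-- Orthogonality of Ramanujan sums. -/
theorem tendsto_mean_ramanujanSum_mul {r q : ℕ} (hr : 1 ≤ r) (hq : 1 ≤ q) :
    Tendsto (fun N : ℕ => (1 / (N : ℂ)) *
        ∑ n ∈ Finset.Icc 1 N, ramanujanSum r n * ramanujanSum q n) atTop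
      (nhds (if r = q then (Nat.totient q : ℂ) else 0)) := by
  have hlim : Tendsto (fun N : ℕ => ∑ x ∈ primitiveRoots q ℂ, ∑ z ∈ primitiveRoots r ℂ,
      (1 / (N : ℂ)) * ∑ n ∈ Finset.Icc 1 N, (z * x) ^ n) atTop
      (nhds (∑ x ∈ primitiveRoots q ℂ, ∑ z ∈ primitiveRoots r ℂ, if z * x = 1 then 1 else 0)) := by
    refine tendsto_finsetSum _ fun x hx => tendsto_finsetSum _ fun z hz => tendsto_mean_pow ?_
    rw [norm_mul, (isPrimitiveRoot_of_mem_primitiveRoots hx).norm'_eq_one (by omega),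
      (isPrimitiveRoot_of_mem_primitiveRoots hz).norm'_eq_one (by omega), one_mul]
  have hval : (∑ x ∈ primitiveRoots q ℂ, ∑ z ∈ primitiveRoots r ℂ,
      if z * x = 1 then (1 : ℂ) else 0) = if r = q then (Nat.totient q : ℂ) else 0 := by
    have hinner : ∀ x ∈ primitiveRoots q ℂ, (∑ z ∈ primitiveRoots r ℂ,
        if z * x = 1 then (1 : ℂ) else 0) = if r = q then 1 else 0 := by
      intro x hx
      have hx' := isPrimitiveRoot_of_mem_primitiveRoots hx
      have hx0 : x ≠ 0 := hx'.ne_zero (by omega)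
      simp only [mul_eq_one_iff_eq_inv₀ hx0, Finset.sum_ite_eq']
      congr 1
      rw [mem_primitiveRoots hr]
      exact propext ⟨fun h => h.unique hx'.inv, fun h => h ▸ hx'.inv⟩
    rw [Finset.sum_congr rfl hinner, Finset.sum_const, Complex.card_primitiveRoots]
    simp
  rw [← hval]
  refine hlim.congr fun N => ?_
  simp_rw [← Finset.mul_sum]
  congr 1
  simp_rw [ramanujanSum_eq_sum_primitiveRoots hr, ramanujanSum_eq_sum_primitiveRoots hq,
    Finset.sum_mul_sum, ← mul_pow]
  rw [Finset.sum_comm' (t' := primitiveRoots r ℂ) (s' := fun _ => primitiveRoots q ℂ) (by tauto),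
    Finset.sum_comm' (t' := primitiveRoots r ℂ) (s' := fun _ => Finset.Icc 1 N) (by tauto)]
  exact Finset.sum_congr rfl fun z _ => Finset.sum_comm

/-- Carmichael's formula for the Ramanujan–Fourier coefficients: if
`a(n) = ∑_{q≥1} a_q c_q(n)` converges absolutely and uniformly in `n`
(witnessed by a summable majorant `M` with `‖a_q c_q(n)‖ ≤ M q` for all `n ≥ 1`),
then `a_q = (1/φ(q)) · lim_{N→∞} (1/N) ∑_{n≤N} a(n) c_q(n)`. -/
theorem ramanujanFourier_coeff_formula (a : ℕ → ℂ) (aq : ℕ → ℂ) (M : ℕ → ℝ)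
    (hbound : ∀ q n : ℕ, 1 ≤ q → 1 ≤ n → ‖aq q * ramanujanSum q n‖ ≤ M q)
    (hM : Summable M)
    (hconv : ∀ n : ℕ, 1 ≤ n →
      HasSum (fun q : ℕ => aq (q + 1) * ramanujanSum (q + 1) n) (a n)) :
    ∀ q : ℕ, 1 ≤ q →
      ∃ L : ℂ,
        Tendsto (fun N : ℕ => (1 / (N : ℂ)) *
            ∑ n ∈ Finset.Icc 1 N, a n * ramanujanSum q n) atTop (nhds L) ∧
        aq q = (1 / (Nat.totient q : ℂ)) * L := by
  intro q hq
  have hφ : (Nat.totient q : ℂ) ≠ 0 := Nat.cast_ne_zero.2 (Nat.totient_pos.2 hq).ne'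
  refine ⟨aq q * Nat.totient q, ?_, by field_simp⟩
  have hterm : ∀ r : ℕ, Tendsto (fun N : ℕ => aq (r + 1) * ((1 / (N : ℂ)) *
      ∑ n ∈ Finset.Icc 1 N, ramanujanSum (r + 1) n * ramanujanSum q n)) atTop
      (nhds (aq (r + 1) * if r + 1 = q then (Nat.totient q : ℂ) else 0)) :=
    fun r => (tendsto_mean_ramanujanSum_mul (by omega) hq).const_mul _
  have hdom : ∀ r N : ℕ, ‖aq (r + 1) * ((1 / (N : ℂ)) *
      ∑ n ∈ Finset.Icc 1 N, ramanujanSum (r + 1) n * ramanujanSum q n)‖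
      ≤ M (r + 1) * Nat.totient q := by
    intro r N
    have hM0 : 0 ≤ M (r + 1) := (norm_nonneg _).trans (hbound (r + 1) 1 (by omega) le_rfl)
    rw [mul_left_comm, Finset.mul_sum, norm_mul, norm_div, norm_one, Complex.norm_natCast,
      one_div_mul_eq_div]
    refine div_le_of_le_mul₀ (by positivity) (by positivity) ?_
    refine (norm_sum_le_of_le (n := fun _ => M (r + 1) * Nat.totient q) _
      fun n hn => ?_).trans_eq (by simp [mul_comm])
    rw [← mul_assoc, norm_mul]
    exact mul_le_mul (hbound _ _ (by omega) (Finset.mem_Icc.1 hn).1) (norm_ramanujanSum_le hq n)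
      (norm_nonneg _) hM0
  have hlim := tendsto_tsum_of_dominated_convergence
    (((summable_nat_add_iff 1).2 hM).mul_right (Nat.totient q : ℝ)) hterm
    (Eventually.of_forall fun N r => hdom r N)
  have hval : ∑' r : ℕ, aq (r + 1) * (if r + 1 = q then (Nat.totient q : ℂ) else 0)
      = aq q * Nat.totient q := by
    obtain ⟨p, rfl⟩ := Nat.exists_eq_add_of_le' hq
    rw [tsum_eq_single p fun r hr => by simp [hr]]
    simp
  rw [hval] at hlim
  refine hlim.congr fun N => HasSum.tsum_eq ?_
  have hsum := (hasSum_sum (s := Finset.Icc 1 N) fun n hn =>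
    (hconv n (Finset.mem_Icc.1 hn).1).mul_right (ramanujanSum q n)).mul_left (1 / (N : ℂ))
  refine hsum.congr_fun fun r => ?_
  rw [mul_left_comm, Finset.mul_sum]
  simp only [mul_assoc]
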